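/- arXiv:2309.00193 — 5 statements merged into one kernel-verified Lean document; each statement's English description precedes it below -/
import Mathlib

section
/- Let U be a nonempty set and let f : U × U → ℝ be symmetric, i.e., f(a,b) = f(b,a) for all a,b ∈ U. If f satisfies the balance condition on U, i.e., f(a,b)·f(b,c)·f(c,a) > 0 for all a,b,c ∈ U, then either (i) f(a,b) > 0 for all a,b ∈ U, or (ii) there exist nonempty disjoint subsets S and T with S ∪ T = U such that for all a,b ∈ U, f(a,b) ≠ 0 and f(a,b) > 0 if and only if (a ∈ S ↔ b ∈ S). (Necessity direction of Theorem 1.) -/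
/-- Necessity direction of Theorem 1: if a symmetric `f` satisfies the balance condition
on a nonempty `U`, then either (i) `f` is everywhere positive, or (ii) `U` splits into
two nonempty disjoint subsets `S`, `T` with the two-group sign structure. -/
theorem balance_necessity {U : Type*} [Nonempty U] (f : U → U → ℝ)
    (hsym : ∀ a b : U, f a b = f b a)
    (hbal : ∀ a b c : U, 0 < f a b * f b c * f c a) :
    (∀ a b : U, 0 < f a b) ∨
      (∃ S T : Set U, S.Nonempty ∧ T.Nonempty ∧ Disjoint S T ∧ S ∪ T = Set.univ ∧
        ∀ a b : U, f a b ≠ 0 ∧ (0 < f a b ↔ (a ∈ S ↔ b ∈ S))) := by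
  have hne : ∀ a b : U, f a b ≠ 0 := by
    intro a b h
    have := hbal a b b
    simp [h] at this
  have key : ∀ p x y : U, 0 < f x y ↔ (0 < f p x ↔ 0 < f p y) := by
    intro p x y
    have h := hbal x y p
    rw [hsym y p] at h
    rcases lt_or_gt_of_ne (hne x y) with h1 | h1 <;>
    rcases lt_or_gt_of_ne (hne p x) with h2 | h2 <;>
    rcases lt_or_gt_of_ne (hne p y) with h3 | h3 <;>
    simp_all [mul_pos_iff, not_lt_of_gt]
  by_cases hp : ∀ a b : U, 0 < f a b
  · exact Or.inl hp
  · right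
    push Not at hp
    obtain ⟨a, b, hab⟩ := hp
    refine ⟨{x | 0 < f a x}, {x | 0 < f a x}ᶜ, ⟨a, (key a a a).2 Iff.rfl⟩,
      ⟨b, not_lt.2 hab⟩, disjoint_compl_right, Set.union_compl_self _, ?_⟩
    intro x y
    exact ⟨hne x y, key a x y⟩
end

section
/- Let K ≥ 1 and let f : {1,…,K} × {1,…,K} → ℝ be symmetric, i.e., f(a,b) = f(b,a) for all a,b. Then f(a,b)·f(b,c)·f(c,a) > 0 for all a,b,c ∈ {1,…,K} if and only if there exist a function g : {1,…,K} → {−1,1} and real constants q_{ab} with q_{ab} = q_{ba} > 0 such that f(a,b) = q_{ab}·g(a)·g(b) for all 1 ≤ a,b ≤ K. (Corollary 1.) -/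
/-- Corollary 1: for a symmetric `f` on a finite set `{1,…,K}`, the balance condition
holds iff `f a b = q a b * g a * g b` for some grouping function `g : {1,…,K} → {−1,1}`
and symmetric positive constants `q a b`. -/
theorem balance_finite_iff (K : ℕ) (hK : 1 ≤ K) (f : Fin K → Fin K → ℝ)
    (hsym : ∀ a b : Fin K, f a b = f b a) :
    (∀ a b c : Fin K, 0 < f a b * f b c * f c a) ↔
      (∃ (g : Fin K → ℝ) (q : Fin K → Fin K → ℝ),
        (∀ a, g a = 1 ∨ g a = -1) ∧ (∀ a b, q a b = q b a) ∧ (∀ a b, 0 < q a b) ∧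
        ∀ a b, f a b = q a b * g a * g b) := by
  constructor
  · intro h
    let z : Fin K := ⟨0, hK⟩
    have hg : ∀ a, ∃ y : ℝ, (y = 1 ∨ y = -1) ∧ 0 < f z a * y := by
      intro a
      have hne : f z a ≠ 0 := by
        intro h0
        have := h z a a
        rw [h0] at this
        simp at this
      rcases lt_or_gt_of_ne hne with h1 | h1
      · exact ⟨-1, Or.inr rfl, by linarith⟩
      · exact ⟨1, Or.inl rfl, by linarith⟩
    choose g hg1 hg2 using hg
    have hsq : ∀ a, g a * g a = 1 := by
      intro a
      rcases hg1 a with h1 | h1 <;> rw [h1] <;> norm_num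
    refine ⟨g, fun a b => f a b * g a * g b, hg1, ?_, ?_, ?_⟩
    · intro a b
      simp only [hsym a b]
      ring
    · intro a b
      have h1 := h z a b
      rw [hsym b z] at h1
      have h2 := mul_pos (hg2 a) (hg2 b)
      have h3 : 0 < (f a b * g a * g b) * (f z a * f z b) ^ 2 := by
        have := mul_pos h1 h2
        nlinarith [this]
      exact pos_of_mul_pos_left h3 (sq_nonneg _)
    · intro a b
      calc f a b = f a b * (g a * g a) * (g b * g b) := by rw [hsq, hsq]; ring
        _ = _ := by ring
  · rintro ⟨g, q, hg, -, hq, hf⟩ a b c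
    have hsq : ∀ a, g a * g a = 1 := by
      intro a
      rcases hg a with h1 | h1 <;> rw [h1] <;> norm_num
    have : f a b * f b c * f c a = q a b * q b c * q c a := by
      calc f a b * f b c * f c a
          = q a b * q b c * q c a * (g a * g a) * (g b * g b) * (g c * g c) := by
            rw [hf a b, hf b c, hf c a]; ring
        _ = _ := by rw [hsq, hsq, hsq]; ring
    rw [this]
    exact mul_pos (mul_pos (hq _ _) (hq _ _)) (hq _ _)
end

section
/- Let (U₀, 𝒜, μ) be a probability measure space, let B : U₀ × U₀ → ℝ be measurable with 0 < B(a,b) < 1 for all a,b, and let f : U₀ × U₀ → ℝ be measurable and symmetric. Suppose there is a measurable set U ⊆ U₀ with μ(U) = 1 such that f(a,b)·f(b,c)·f(c,a) > 0 for all a,b,c ∈ U. Then ∫_{U₀×U₀×U₀} B(a,b)·B(b,c)·B(c,a)·tanh(f(a,b)/2)·tanh(f(b,c)/2)·tanh(f(c,a)/2) d(μ⊗μ⊗μ)(a,b,c) > 0, and ∫_{U₀×U₀×U₀} B(a,b)·B(b,c)·B(c,a) d(μ⊗μ⊗μ)(a,b,c) > 0. (Integral form of Proposition 1: the ratio of these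 two integrals equals E(A_ij·A_jℓ·A_ℓi | |A_ij·A_jℓ·A_ℓi| = 1) under the latent space model, so the signed network is population-level balanced.) -/
open MeasureTheory

theorem aux_integral_pos {α : Type*} [MeasurableSpace α] (ν : Measure α) [IsProbabilityMeasure ν]
    (g : α → ℝ) (hg : Measurable g) (hb : ∀ x, |g x| ≤ 1) (hp : ∀ᵐ x ∂ν, 0 < g x) :
    0 < ∫ x, g x ∂ν := by
  have hi : Integrable g ν :=
    Integrable.of_bound hg.aestronglyMeasurable 1 (Filter.Eventually.of_forall hb)
  rw [integral_pos_iff_support_of_nonneg_ae (hp.mono fun x hx => hx.le) hi]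
  have h1 : ν (Function.support g) = 1 := by
    refine (prob_compl_eq_zero_iff (measurableSet_support hg)).1 ?_
    refine measure_mono_null ?_ (ae_iff.1 hp)
    intro x hx hx'
    exact hx hx'.ne'
  rw [h1]; exact one_pos

theorem aux_tanh (x : ℝ) (hx : x ≠ 0) : ∃ k : ℝ, 0 < k ∧ Real.tanh (x / 2) = k * x := by
  refine ⟨Real.tanh (x / 2) / x, ?_, by field_simp⟩
  rw [Real.tanh_eq_sinh_div_cosh]
  have hc := Real.cosh_pos (x / 2)
  rcases lt_or_gt_of_ne hx with h | h
  · exact div_pos_of_neg_of_neg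
      (div_neg_of_neg_of_pos (Real.sinh_neg_iff.2 (by linarith)) hc) h
  · exact div_pos (div_pos (Real.sinh_pos_iff.2 (by linarith)) hc) h

theorem aux_meas_tanh : Measurable Real.tanh := by
  have : Real.tanh = fun x => Real.sinh x / Real.cosh x :=
    funext Real.tanh_eq_sinh_div_cosh
  rw [this]
  exact Real.measurable_sinh.div Real.measurable_cosh

theorem aux_mul {a b : ℝ} (ha : |a| ≤ 1) (hb : |b| ≤ 1) : |a * b| ≤ 1 := by
  rw [abs_mul]; exact mul_le_one₀ ha (abs_nonneg _) hb

/-- Integral form of Proposition 1: if the balance condition `f a b * f b c * f c a > 0`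
holds on a set `U` of probability 1, then both the expected product of edge signs over a
triangle (the `tanh`-weighted integral) and the triangle probability (the `B`-only
integral) are strictly positive. -/
theorem population_level_balance_integral {U₀ : Type*} [MeasurableSpace U₀]
    (μ : Measure U₀) [IsProbabilityMeasure μ]
    (B f : U₀ → U₀ → ℝ)
    (hBmeas : Measurable fun p : U₀ × U₀ => B p.1 p.2)
    (hB : ∀ a b : U₀, 0 < B a b ∧ B a b < 1)
    (hfmeas : Measurable fun p : U₀ × U₀ => f p.1 p.2)
    (hfsym : ∀ a b : U₀, f a b = f b a)
    (U : Set U₀) (hUmeas : MeasurableSet U) (hμU : μ U = 1)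
    (hbal : ∀ a ∈ U, ∀ b ∈ U, ∀ c ∈ U, 0 < f a b * f b c * f c a) :
    (0 < ∫ p : U₀ × U₀ × U₀,
        B p.1 p.2.1 * B p.2.1 p.2.2 * B p.2.2 p.1 *
          Real.tanh (f p.1 p.2.1 / 2) * Real.tanh (f p.2.1 p.2.2 / 2) *
          Real.tanh (f p.2.2 p.1 / 2) ∂(μ.prod (μ.prod μ))) ∧
    (0 < ∫ p : U₀ × U₀ × U₀,
        B p.1 p.2.1 * B p.2.1 p.2.2 * B p.2.2 p.1 ∂(μ.prod (μ.prod μ))) := by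
  have hBb : ∀ a b, |B a b| ≤ 1 := fun a b => by
    rw [abs_of_pos (hB a b).1]; exact (hB a b).2.le
  have ht : ∀ x, |Real.tanh x| ≤ 1 := fun x => (Real.abs_tanh_lt_one x).le
  have m1 : Measurable fun p : U₀ × U₀ × U₀ => (p.1, p.2.1) := by fun_prop
  have m2 : Measurable fun p : U₀ × U₀ × U₀ => (p.2.1, p.2.2) := by fun_prop
  have m3 : Measurable fun p : U₀ × U₀ × U₀ => (p.2.2, p.1) := by fun_prop
  have hBm : Measurable fun p : U₀ × U₀ × U₀ =>
      B p.1 p.2.1 * B p.2.1 p.2.2 * B p.2.2 p.1 :=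
    ((hBmeas.comp m1).mul (hBmeas.comp m2)).mul (hBmeas.comp m3)
  have hU : ∀ᵐ a ∂μ, a ∈ U := by
    rw [ae_iff]
    exact (prob_compl_eq_zero_iff hUmeas).2 hμU
  have hBp : ∀ a b c, 0 < B a b * B b c * B c a := fun a b c =>
    mul_pos (mul_pos (hB _ _).1 (hB _ _).1) (hB _ _).1
  constructor
  · refine aux_integral_pos _ _ ?_ ?_ ?_
    · exact ((hBm.mul (aux_meas_tanh.comp ((hfmeas.comp m1).div_const 2))).mul
        (aux_meas_tanh.comp ((hfmeas.comp m2).div_const 2))).mul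
        (aux_meas_tanh.comp ((hfmeas.comp m3).div_const 2))
    · intro p
      exact aux_mul (aux_mul (aux_mul (aux_mul (aux_mul (hBb _ _) (hBb _ _)) (hBb _ _))
        (ht _)) (ht _)) (ht _)
    · have h1 : ∀ᵐ p ∂(μ.prod (μ.prod μ)), p.1 ∈ U :=
        Measure.quasiMeasurePreserving_fst.ae hU
      have h2 : ∀ᵐ p ∂(μ.prod (μ.prod μ)), p.2.1 ∈ U :=
        Measure.quasiMeasurePreserving_snd.ae (Measure.quasiMeasurePreserving_fst.ae hU)
      have h3 : ∀ᵐ p ∂(μ.prod (μ.prod μ)), p.2.2 ∈ U :=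
        Measure.quasiMeasurePreserving_snd.ae (Measure.quasiMeasurePreserving_snd.ae hU)
      filter_upwards [h1, h2, h3] with p ha hb hc
      have h := hbal _ ha _ hb _ hc
      have hne := h.ne'
      obtain ⟨k, hk, ek⟩ := aux_tanh (f p.1 p.2.1) (fun h0 => by simp [h0] at hne)
      obtain ⟨l, hl, el⟩ := aux_tanh (f p.2.1 p.2.2) (fun h0 => by simp [h0] at hne)
      obtain ⟨m, hm, em⟩ := aux_tanh (f p.2.2 p.1) (fun h0 => by simp [h0] at hne)
      rw [ek, el, em]
      have := mul_pos (mul_pos (hBp p.1 p.2.1 p.2.2) (mul_pos (mul_pos hk hl) hm)) h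
      linarith
  · refine aux_integral_pos _ _ hBm ?_ (Filter.Eventually.of_forall fun p => hBp _ _ _)
    intro p
    exact aux_mul (aux_mul (hBb _ _) (hBb _ _)) (hBb _ _)
end

section
/- Let n ≥ 1, 1 ≤ k ≤ n, and let α, ᾱ ∈ ℝⁿ, Z, Z̄ ∈ ℝ^{n×k}, v, v̄ ∈ ℝⁿ satisfy J_n Z = Z, J_n Z̄ = Z̄, and rank(Z) = k. Then α·1_nᵀ + 1_n·αᵀ + Z·Zᵀ = ᾱ·1_nᵀ + 1_n·ᾱᵀ + Z̄·Z̄ᵀ and v·vᵀ = v̄·v̄ᵀ hold simultaneously if and only if there exist an orthogonal matrix O ∈ ℝ^{k×k} (OᵀO = OOᵀ = I_k) and κ ∈ {−1, 1} such that α = ᾱ, Z = Z̄·O, and v = κ·v̄. (Proposition 3: identifiability of the separate inner-product model.) -/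
open Matrix

/-- The n×n centering matrix `J_n = I_n − (1/n) 1_n 1_nᵀ`. -/
noncomputable def centeringMatrix (n : ℕ) : Matrix (Fin n) (Fin n) ℝ :=
  1 - (n : ℝ)⁻¹ • Matrix.vecMulVec 1 1

theorem colsum_zero_aux (n k : ℕ) (hn : 1 ≤ n) (Z : Matrix (Fin n) (Fin k) ℝ)
    (hZ : centeringMatrix n * Z = Z) (j : Fin k) : ∑ i, Z i j = 0 := by
  have h := congrFun (congrFun hZ ⟨0, hn⟩) j
  have hn0 : (n : ℝ) ≠ 0 := by positivity
  rw [centeringMatrix, Matrix.sub_mul, Matrix.one_mul, Matrix.smul_mul, Matrix.sub_apply,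
    Matrix.smul_apply, Matrix.mul_apply] at h
  simp only [Matrix.vecMulVec_apply, Pi.one_apply, mul_one, one_mul, smul_eq_mul] at h
  have h2 : (n : ℝ)⁻¹ * ∑ i, Z i j = 0 := by linarith
  rcases mul_eq_zero.mp h2 with h3 | h3
  · exact absurd h3 (inv_ne_zero hn0)
  · exact h3

theorem rowsum_zero_aux (n k : ℕ) (hn : 1 ≤ n) (Z : Matrix (Fin n) (Fin k) ℝ)
    (hZ : centeringMatrix n * Z = Z) (i : Fin n) : ∑ j, (Z * Zᵀ) i j = 0 := by
  simp only [Matrix.mul_apply, Matrix.transpose_apply]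
  rw [Finset.sum_comm]
  refine Finset.sum_eq_zero fun l _ => ?_
  rw [← Finset.mul_sum, colsum_zero_aux n k hn Z hZ l, mul_zero]

theorem separate_model_identifiability (n k : ℕ) (hn : 1 ≤ n) (hk : 1 ≤ k) (hkn : k ≤ n)
    (α α' : Fin n → ℝ) (Z Z' : Matrix (Fin n) (Fin k) ℝ) (v v' : Fin n → ℝ)
    (hZ : centeringMatrix n * Z = Z) (hZ' : centeringMatrix n * Z' = Z')
    (hrank : Z.rank = k) :
    (Matrix.vecMulVec α 1 + Matrix.vecMulVec 1 α + Z * Zᵀ =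
        Matrix.vecMulVec α' 1 + Matrix.vecMulVec 1 α' + Z' * Z'ᵀ ∧
      Matrix.vecMulVec v v = Matrix.vecMulVec v' v') ↔
    (∃ (O : Matrix (Fin k) (Fin k) ℝ) (κ : ℝ),
      Oᵀ * O = 1 ∧ O * Oᵀ = 1 ∧ (κ = 1 ∨ κ = -1) ∧
      α = α' ∧ Z = Z' * O ∧ v = κ • v') := by
  constructor
  · rintro ⟨hT, hv⟩
    have hn0 : (0 : ℝ) < n := by positivity
    have hrow : ∀ i, (n : ℝ) * α i + ∑ j, α j = n * α' i + ∑ j, α' j := by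
      intro i
      have h : ∑ j, (Matrix.vecMulVec α 1 + Matrix.vecMulVec 1 α + Z * Zᵀ : Matrix (Fin n) (Fin n) ℝ) i j =
        ∑ j, (Matrix.vecMulVec α' 1 + Matrix.vecMulVec 1 α' + Z' * Z'ᵀ :
          Matrix (Fin n) (Fin n) ℝ) i j := by rw [hT]
      simp only [Matrix.add_apply, Finset.sum_add_distrib, rowsum_zero_aux n k hn Z hZ,
        rowsum_zero_aux n k hn Z' hZ', Matrix.vecMulVec_apply, Pi.one_apply, mul_one, one_mul,
        Finset.sum_const, Finset.card_univ, Fintype.card_fin, nsmul_eq_mul, add_zero] at h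
      exact h
    have hS : ∑ j, α j = ∑ j, α' j := by
      have h : ∑ i, ((n : ℝ) * α i + ∑ j, α j) = ∑ i, (n * α' i + ∑ j, α' j) :=
        Finset.sum_congr rfl fun i _ => hrow i
      simp only [Finset.sum_add_distrib, ← Finset.mul_sum, Finset.sum_const, Finset.card_univ,
        Fintype.card_fin, nsmul_eq_mul] at h
      apply mul_left_cancel₀ hn0.ne'
      linarith
    have hα : α = α' := by
      funext i
      apply mul_left_cancel₀ hn0.ne'
      linarith [hrow i]
    subst hα
    have hZZ : Z * Zᵀ = Z' * Z'ᵀ := add_left_cancel hT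
    have hG : IsUnit (Zᵀ * Z) := by
      rw [← Matrix.linearIndependent_cols_iff_isUnit, linearIndependent_iff_card_eq_finrank_span,
        Set.finrank, ← Matrix.rank_eq_finrank_span_cols, Matrix.rank_transpose_mul_self, hrank,
        Fintype.card_fin]
    have hGd : IsUnit (Zᵀ * Z).det := (Matrix.isUnit_iff_isUnit_det _).mp hG
    have hO1 : (Z'ᵀ * Z * (Zᵀ * Z)⁻¹)ᵀ * (Z'ᵀ * Z * (Zᵀ * Z)⁻¹) = 1 := by
      have e : (Z'ᵀ * Z * (Zᵀ * Z)⁻¹)ᵀ = (Zᵀ * Z)⁻¹ * (Zᵀ * Z') := by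
        simp only [Matrix.transpose_mul, Matrix.transpose_nonsing_inv, Matrix.transpose_transpose]
      calc _ = (Zᵀ * Z)⁻¹ * Zᵀ * (Z' * Z'ᵀ) * Z * (Zᵀ * Z)⁻¹ := by
            rw [e]; simp only [Matrix.mul_assoc]
        _ = ((Zᵀ * Z)⁻¹ * (Zᵀ * Z)) * ((Zᵀ * Z) * (Zᵀ * Z)⁻¹) := by
            rw [← hZZ]; simp only [Matrix.mul_assoc]
        _ = 1 := by
            rw [Matrix.nonsing_inv_mul _ hGd, Matrix.mul_nonsing_inv _ hGd, Matrix.one_mul]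
    have hZO : Z = Z' * (Z'ᵀ * Z * (Zᵀ * Z)⁻¹) := by
      symm
      calc _ = (Z' * Z'ᵀ) * Z * (Zᵀ * Z)⁻¹ := by simp only [Matrix.mul_assoc]
        _ = Z * ((Zᵀ * Z) * (Zᵀ * Z)⁻¹) := by rw [← hZZ]; simp only [Matrix.mul_assoc]
        _ = Z := by rw [Matrix.mul_nonsing_inv _ hGd, Matrix.mul_one]
    have hvv : ∀ i j, v i * v j = v' i * v' j := fun i j => congrFun (congrFun hv i) j
    have hκ : ∃ κ : ℝ, (κ = 1 ∨ κ = -1) ∧ v = κ • v' := by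
      by_cases h0 : ∃ i, v' i ≠ 0
      · obtain ⟨i, hi⟩ := h0
        rcases mul_self_eq_mul_self_iff.mp (hvv i i) with h | h
        · refine ⟨1, Or.inl rfl, ?_⟩
          funext j
          have := hvv i j
          rw [h] at this
          simpa using mul_left_cancel₀ hi this
        · refine ⟨-1, Or.inr rfl, ?_⟩
          funext j
          have := hvv i j
          rw [h] at this
          apply mul_left_cancel₀ hi
          simp only [Pi.smul_apply, smul_eq_mul]
          linarith
      · push Not at h0
        refine ⟨1, Or.inl rfl, ?_⟩
        funext j
        have := hvv j j
        rw [h0 j] at this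
        simp only [Pi.smul_apply, smul_eq_mul, h0 j, mul_zero] at this ⊢
        exact mul_self_eq_zero.mp this
    obtain ⟨κ, hκ1, hκ2⟩ := hκ
    exact ⟨_, κ, hO1, mul_eq_one_comm.mp hO1, hκ1, rfl, hZO, hκ2⟩
  · rintro ⟨O, κ, -, hO, hκ, rfl, rfl, rfl⟩
    constructor
    · congr 1
      rw [Matrix.transpose_mul, Matrix.mul_assoc, ← Matrix.mul_assoc O, hO, Matrix.one_mul]
    · ext i j
      rcases hκ with rfl | rfl <;> simp [Matrix.vecMulVec_apply]
end

section
/- Let U be a nonempty set and f : U × U → ℝ be symmetric, i.e., f(a,b) = f(b,a) for all a,b ∈ U, and suppose f(a,b)·f(b,c)·f(c,a) > 0 for all a,b,c ∈ U. Define the relation a ~ b on U by f(a,b) > 0. Then ~ is an equivalence relation on U (reflexive, symmetric, and transitive), and it has at most two equivalence classes: for any a, b, c ∈ U, at least one of a ~ b, b ~ c, a ~ c holds. -/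
/-- Structural statement underlying Theorem 1: under symmetry and the balance condition,
`a ~ b ↔ f a b > 0` is an equivalence relation with at most two equivalence classes. -/
theorem balance_equivalence_two_classes {U : Type*} [Nonempty U] (f : U → U → ℝ)
    (hsym : ∀ a b : U, f a b = f b a)
    (hbal : ∀ a b c : U, 0 < f a b * f b c * f c a) :
    Equivalence (fun a b : U => 0 < f a b) ∧
      ∀ a b c : U, 0 < f a b ∨ 0 < f b c ∨ 0 < f a c := by
  refine ⟨⟨fun a => ?_, fun {a b} h => ?_, fun {a b c} h1 h2 => ?_⟩, fun a b c => ?_⟩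
  · by_contra hn
    have h := hbal a a a
    have hn' : f a a ≤ 0 := not_lt.mp hn
    have := mul_nonpos_of_nonneg_of_nonpos (mul_self_nonneg (f a a)) hn'
    linarith
  · have h' : 0 < f a b := h
    rw [hsym] at h'
    exact h'
  · have h := hbal a b c
    have h3 : 0 < f c a := (mul_pos_iff_of_pos_left (mul_pos h1 h2)).mp h
    rw [hsym] at h3
    exact h3
  · by_contra! hn
    obtain ⟨h1, h2, h3⟩ := hn
    have h := hbal a b c
    rw [hsym c a] at h
    have := mul_nonpos_of_nonneg_of_nonpos (mul_nonneg_of_nonpos_of_nonpos h1 h2) h3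
    linarith
end
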